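/- Let α > 0 and let φ : ℝ → ℝ be a C¹ function with φ'(u)² = α² + cos²φ(u) for all u, φ(0) = 0 and φ'(u) < 0 for all u. Define h : ℝ² → ℝ by h(u,v) = cos φ(u)·cosh(αv)/(α·(φ'(u) − α)). Then at every point (u,v) with cos φ(u) > 0, the function h satisfies h_{zz} = α·tan φ(u)·h_z + cosh(αv)/(4·cos φ(u)) and h_{z z̄} = (φ'(u) + α)²·cosh(αv)/(4·cos³φ(u)), where subscripts denote Wirtinger derivatives with respect to z = u + iv. -/

import Mathlib

open Real Filter

noncomputable def Ccoef (α θ : ℝ) : ℝ := Real.sin (2 * θ) / (2 * α)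

noncomputable def Ppoly (α θ x : ℝ) : ℝ :=
  α ^ 2 + Real.cos (2 * θ) * x ^ 2 - Ccoef α θ ^ 2 * x ^ 4

noncomputable def thetaPlus (α : ℝ) : ℝ :=
  if 1 < α then Real.pi / 2 else (1 / 2) * Real.arccos (1 - 2 * α ^ 2)

def inOmega (α θ : ℝ) : Prop := 0 < α ∧ -thetaPlus α < θ ∧ θ < thetaPlus α

noncomputable def Lint (α θ : ℝ) : ℝ :=
  ∫ x in (-1 : ℝ)..1,
    (2 * α * Ccoef α θ ^ 2 * x ^ 2 - α * Real.cos (2 * θ)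
        + Ccoef α θ ^ 2 * x ^ 2 * Real.sqrt (Ppoly α θ x)) /
      (Real.sqrt ((1 - x ^ 2) * Ppoly α θ x) * (α + Real.sqrt (Ppoly α θ x)))

/-- Wirtinger derivative `f_z = (f_u - i f_v)/2` of a map `f : ℝ² → ℂ`. -/
noncomputable def wz (f : ℝ × ℝ → ℂ) (p : ℝ × ℝ) : ℂ :=
  (deriv (fun t => f (t, p.2)) p.1 - Complex.I * deriv (fun t => f (p.1, t)) p.2) / 2

/-- Wirtinger derivative `f_z̄ = (f_u + i f_v)/2` of a map `f : ℝ² → ℂ`. -/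
noncomputable def wzbar (f : ℝ × ℝ → ℂ) (p : ℝ × ℝ) : ℂ :=
  (deriv (fun t => f (t, p.2)) p.1 + Complex.I * deriv (fun t => f (p.1, t)) p.2) / 2

theorem wz_eq_of_hasDerivAt {f : ℝ × ℝ → ℂ} {p : ℝ × ℝ} {a b : ℂ}
    (ha : HasDerivAt (fun t => f (t, p.2)) a p.1) (hb : HasDerivAt (fun t => f (p.1, t)) b p.2) :
    wz f p = (a - Complex.I * b) / 2 := by
  rw [wz, ha.deriv, hb.deriv]

theorem wzbar_eq_of_hasDerivAt {f : ℝ × ℝ → ℂ} {p : ℝ × ℝ} {a b : ℂ}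
    (ha : HasDerivAt (fun t => f (t, p.2)) a p.1) (hb : HasDerivAt (fun t => f (p.1, t)) b p.2) :
    wzbar f p = (a + Complex.I * b) / 2 := by
  rw [wzbar, ha.deriv, hb.deriv]

/-- A negative solution of `φ'² = α² + cos² φ` satisfies `φ'' = -cos φ sin φ`. -/
theorem hasDerivAt_of_sq_eq_add_cos_sq {α : ℝ} {φ φd : ℝ → ℝ}
    (hφ : ∀ u, HasDerivAt φ (φd u) u)
    (hode : ∀ u, (φd u) ^ 2 = α ^ 2 + Real.cos (φ u) ^ 2) (hφneg : ∀ u, φd u < 0) (u : ℝ) :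
    HasDerivAt φd (-(Real.cos (φ u) * Real.sin (φ u))) u := by
  have hsqrt (x : ℝ) : Real.sqrt (α ^ 2 + Real.cos (φ x) ^ 2) = -φd x := by
    rw [← hode, Real.sqrt_sq_eq_abs, abs_of_neg (hφneg x)]
  have hfun : φd = fun x => -Real.sqrt (α ^ 2 + Real.cos (φ x) ^ 2) := by
    funext x
    rw [hsqrt, neg_neg]
  have hne : α ^ 2 + Real.cos (φ u) ^ 2 ≠ 0 := by
    rw [← hode]
    exact pow_ne_zero 2 (hφneg u).ne
  have hd := ((((hφ u).cos.pow 2).const_add (α ^ 2)).sqrt hne).neg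
  have hval : -(Real.cos (φ u) * Real.sin (φ u)) =
      -((2 : ℕ) * Real.cos (φ u) ^ (2 - 1) * (-Real.sin (φ u) * φd u) /
        (2 * Real.sqrt (α ^ 2 + Real.cos (φ u) ^ 2))) := by
    rw [hsqrt]
    have := (hφneg u).ne
    push_cast
    field_simp
  rw [hval]
  exact hd.congr_of_eventuallyEq (Eventually.of_forall fun x => congrFun hfun x)

/-- Wirtinger derivatives of `A(u) cosh(αv)`. -/
theorem wirtinger_mul_cosh {α : ℝ} {A B B' : ℝ → ℝ} (hA : ∀ u, HasDerivAt A (B u) u)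
    (hB : ∀ u, HasDerivAt B (B' u) u) (p : ℝ × ℝ) :
    wz (fun q => ((A q.1 * Real.cosh (α * q.2) : ℝ) : ℂ)) p =
        ((B p.1 * Real.cosh (α * p.2) : ℝ) -
          Complex.I * (A p.1 * (α * Real.sinh (α * p.2)) : ℝ)) / 2 ∧
      wz (wz (fun q => ((A q.1 * Real.cosh (α * q.2) : ℝ) : ℂ))) p =
        (((B' p.1 - α ^ 2 * A p.1) * Real.cosh (α * p.2) : ℝ) -
          2 * Complex.I * (α * B p.1 * Real.sinh (α * p.2) : ℝ)) / 4 ∧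
      wzbar (wz (fun q => ((A q.1 * Real.cosh (α * q.2) : ℝ) : ℂ))) p =
        (((B' p.1 + α ^ 2 * A p.1) * Real.cosh (α * p.2) : ℝ) : ℂ) / 4 := by
  have hC (v : ℝ) : HasDerivAt (fun t => Real.cosh (α * t)) (α * Real.sinh (α * v)) v := by
    simpa [mul_comm] using ((hasDerivAt_id v).const_mul α).cosh
  have hS (v : ℝ) : HasDerivAt (fun t => Real.sinh (α * t)) (α * Real.cosh (α * v)) v := by
    simpa [mul_comm] using ((hasDerivAt_id v).const_mul α).sinh
  have hz : wz (fun q => ((A q.1 * Real.cosh (α * q.2) : ℝ) : ℂ)) = fun p =>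
      ((B p.1 * Real.cosh (α * p.2) : ℝ) -
        Complex.I * (A p.1 * (α * Real.sinh (α * p.2)) : ℝ)) / 2 := by
    funext q
    exact wz_eq_of_hasDerivAt ((hA q.1).mul_const (Real.cosh (α * q.2))).ofReal_comp
      ((hC q.2).const_mul (A q.1)).ofReal_comp
  have hu := ((((hB p.1).mul_const (Real.cosh (α * p.2))).ofReal_comp).sub
    ((((hA p.1).mul_const (α * Real.sinh (α * p.2))).ofReal_comp).const_mul
      Complex.I)).div_const 2
  have hv := ((((hC p.2).const_mul (B p.1)).ofReal_comp).sub
    (((((hS p.2).const_mul α).const_mul (A p.1)).ofReal_comp).const_mul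
      Complex.I)).div_const 2
  rw [hz]
  refine ⟨rfl, ?_, ?_⟩
  · rw [wz_eq_of_hasDerivAt hu hv]
    push_cast
    linear_combination
      ((α : ℂ) ^ 2 * A p.1 * Complex.cosh (α * p.2)) / 4 * Complex.I_sq
  · rw [wzbar_eq_of_hasDerivAt hu hv]
    push_cast
    linear_combination
      -((α : ℂ) ^ 2 * A p.1 * Complex.cosh (α * p.2)) / 4 * Complex.I_sq

/-- The explicit height function `h(u,v) = cos φ(u)·cosh(αv)/(α(φ'(u) - α))` satisfies the
Fernandez–Mira system `h_{zz} = α·tan φ·h_z + cosh(αv)/(4 cos φ)` and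
`h_{z z̄} = (φ' + α)²·cosh(αv)/(4 cos³φ)` wherever `cos φ(u) > 0`. -/
theorem statement_19 {α : ℝ} (hα : 0 < α) (φ φd : ℝ → ℝ)
    (hφ : ∀ u, HasDerivAt φ (φd u) u) (hφc : Continuous φd)
    (hode : ∀ u, (φd u) ^ 2 = α ^ 2 + Real.cos (φ u) ^ 2)
    (hφ0 : φ 0 = 0) (hφneg : ∀ u, φd u < 0)
    (h : ℝ × ℝ → ℝ)
    (hh : ∀ p : ℝ × ℝ, h p =
      Real.cos (φ p.1) * Real.cosh (α * p.2) / (α * (φd p.1 - α))) :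
    ∀ p : ℝ × ℝ, 0 < Real.cos (φ p.1) →
      wz (wz (fun q => ((h q : ℝ) : ℂ))) p =
        (α : ℂ) * (Real.tan (φ p.1) : ℂ) * wz (fun q => ((h q : ℝ) : ℂ)) p
          + (Real.cosh (α * p.2) : ℂ) / (4 * (Real.cos (φ p.1) : ℂ)) ∧
      wzbar (wz (fun q => ((h q : ℝ) : ℂ))) p =
        ((φd p.1 + α) ^ 2 : ℝ) * (Real.cosh (α * p.2) : ℂ)
          / (4 * (Real.cos (φ p.1) : ℂ) ^ 3) := by
  intro p hp
  have hne (u : ℝ) : φd u - α ≠ 0 := by linarith [hφneg u]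
  have hd := hasDerivAt_of_sq_eq_add_cos_sq hφ hode hφneg
  have hA (u : ℝ) : HasDerivAt (fun t => Real.cos (φ t) / (α * (φd t - α)))
      (Real.sin (φ u) / (φd u - α)) u := by
    refine ((hφ u).cos.div (((hd u).sub_const α).const_mul α)
      (mul_ne_zero hα.ne' (hne u))).congr_deriv ?_
    have := hne u
    field_simp
    linear_combination -Real.sin (φ u) * hode u
  have hB (u : ℝ) : HasDerivAt (fun t => Real.sin (φ t) / (φd t - α))
      ((Real.cos (φ u) * φd u * (φd u - α) + Real.sin (φ u) ^ 2 * Real.cos (φ u)) /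
        (φd u - α) ^ 2) u := by
    refine ((hφ u).sin.div ((hd u).sub_const α) (hne u)).congr_deriv ?_
    ring
  have hfun : (fun q => ((h q : ℝ) : ℂ)) = fun q : ℝ × ℝ =>
      ((Real.cos (φ q.1) / (α * (φd q.1 - α)) * Real.cosh (α * q.2) : ℝ) : ℂ) := by
    funext q
    rw [hh, div_mul_eq_mul_div]
  obtain ⟨hz, hzz, hzzbar⟩ := wirtinger_mul_cosh (α := α) hA hB p
  rw [hfun, hzz, hz, hzzbar]
  have hode' := hode p.1
  have hsc := Real.sin_sq_add_cos_sq (φ p.1)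
  have hd0 := hne p.1
  rw [Real.tan_eq_sin_div_cos]
  generalize Real.cos (φ p.1) = c at *
  generalize Real.sin (φ p.1) = s at *
  generalize φd p.1 = d at *
  generalize Real.cosh (α * p.2) = C
  generalize Real.sinh (α * p.2) = S
  have hc0 := hp.ne'
  have hα0 := hα.ne'
  have hre : (c * d * (d - α) + s ^ 2 * c) / (d - α) ^ 2 - α ^ 2 * (c / (α * (d - α))) =
      2 * α * (s / c) * (s / (d - α)) + 1 / c := by
    field_simp
    linear_combination (d - α) ^ 2 * hsc - s ^ 2 * hode'
  have him : α * (s / (d - α)) = α * (s / c) * (c / (α * (d - α)) * α) := by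
    field_simp
  have hbar : (c * d * (d - α) + s ^ 2 * c) / (d - α) ^ 2 + α ^ 2 * (c / (α * (d - α))) =
      (d + α) ^ 2 / c ^ 3 := by
    field_simp
    linear_combination c ^ 4 * hsc + (c ^ 4 - (d ^ 2 - α ^ 2 + c ^ 2)) * hode'
  constructor
  · rw [hre, him]
    push_cast
    ring
  · rw [hbar]
    push_cast
    ring
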